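/- Let G = (N^k, Θ) be a downward directed lattice graph. The family Q = {t̂_D : D ⊆ N^k finite} of relaxed terminal label functions is jump-free: for all finite A, B ⊆ N^k and all x ∈ A ∩ B, if A_x ⊆ B_x and t̂_A(y) = t̂_B(y) for all y ∈ A_x, then t̂_A(x) ≥ t̂_B(x). -/

import Mathlib

namespace LatticeMultiverse

/-- Maximum coordinate value of a lattice point `x ∈ ℕ^k`. -/
noncomputable def vmax {k : ℕ} (x : Fin k → ℕ) : ℕ := sSup (Set.range x)

/-- Minimum coordinate value of a lattice point `x ∈ ℕ^k`. -/
noncomputable def vmin {k : ℕ} (x : Fin k → ℕ) : ℕ := sInf (Set.range x)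

/-- `G = (ℕ^k, Θ)` is a downward directed lattice graph:
every edge `(x, y) ∈ Θ` satisfies `max x > max y`. -/
def Downward {k : ℕ} (Θ : Set ((Fin k → ℕ) × (Fin k → ℕ))) : Prop :=
  ∀ e ∈ Θ, vmax e.2 < vmax e.1

/-- A path in the induced subgraph `G_D`: a nonempty list of distinct vertices of `D`
with consecutive pairs being edges of `Θ` (hence of `Θ_D`). -/
def IsPath {k : ℕ} (Θ : Set ((Fin k → ℕ) × (Fin k → ℕ))) (D : Finset (Fin k → ℕ))
    (l : List (Fin k → ℕ)) : Prop :=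
  l ≠ [] ∧ l.Nodup ∧ (∀ x ∈ l, x ∈ D) ∧ l.Chain' (fun a b => (a, b) ∈ Θ)

/-- A terminal path in `G_D`: a path admitting no one-vertex extension. -/
def IsTerminalPath {k : ℕ} (Θ : Set ((Fin k → ℕ) × (Fin k → ℕ))) (D : Finset (Fin k → ℕ))
    (l : List (Fin k → ℕ)) : Prop :=
  IsPath Θ D l ∧ ∀ y, ¬ IsPath Θ D (l ++ [y])

/-- `T_D(z)`: the set of last vertices of terminal paths in `G_D` starting at `z`. -/
def TD {k : ℕ} (Θ : Set ((Fin k → ℕ) × (Fin k → ℕ))) (D : Finset (Fin k → ℕ))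
    (z : Fin k → ℕ) : Set (Fin k → ℕ) :=
  {w | ∃ l, IsTerminalPath Θ D l ∧ l.head? = some z ∧ l.getLast? = some w}

/-- The terminal label function `t_D(z) = min({min x : x ∈ T_D(z)} ∪ {min z})`. -/
noncomputable def tD {k : ℕ} (Θ : Set ((Fin k → ℕ) × (Fin k → ℕ))) (D : Finset (Fin k → ℕ))
    (z : Fin k → ℕ) : ℕ :=
  sInf (vmin '' TD Θ D z ∪ {vmin z})

open Classical in
/-- The relaxed terminal label function `t̂_D`: `max z` if the one-vertex path `(z)` is
terminal in `G_D`, and `t_D z` otherwise. -/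
noncomputable def tDhat {k : ℕ} (Θ : Set ((Fin k → ℕ) × (Fin k → ℕ))) (D : Finset (Fin k → ℕ))
    (z : Fin k → ℕ) : ℕ :=
  if IsTerminalPath Θ D [z] then vmax z else tD Θ D z

/-- Two `k`-tuples have the same order type. -/
def SameOrderType {k : ℕ} (x y : Fin k → ℕ) : Prop :=
  (∀ i j, x i < x j ↔ y i < y j) ∧ (∀ i j, x i = x j ↔ y i = y j)

/-- The cube `E^k ⊆ ℕ^k`. -/
def cube (k : ℕ) (E : Finset ℕ) : Finset (Fin k → ℕ) := Fintype.piFinset fun _ => E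

/-- `f` is regressively regular over `E^k`: for each order type of `k`-tuples,
either `f x ≥ min x` for all `x ∈ E^k` of that order type, or
`f x = f y < min E` for all `x, y ∈ E^k` of that order type. -/
def RegressivelyRegular {k : ℕ} (E : Finset ℕ) (f : (Fin k → ℕ) → ℕ) : Prop :=
  ∀ x ∈ cube k E,
    (∀ y ∈ cube k E, SameOrderType x y → vmin y ≤ f y) ∨
    (∀ y ∈ cube k E, ∀ z ∈ cube k E, SameOrderType x y → SameOrderType x z →
      f y = f z ∧ f y < sInf (E : Set ℕ))

/-- The set of `f`-significant labels of `S`: `{f z : z ∈ S, f z < min z}`. -/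
def sigLabels {k : ℕ} (f : (Fin k → ℕ) → ℕ) (S : Set (Fin k → ℕ)) : Set ℕ :=
  f '' {z ∈ S | f z < vmin z}

/-- A family of functions with finite domains is encoded as a set of pairs `(D, f)`,
`D` the domain.  Full: every finite `D` is the domain of some member. -/
def FullFam {k : ℕ} (Q : Set (Finset (Fin k → ℕ) × ((Fin k → ℕ) → ℕ))) : Prop :=
  ∀ D, ∃ f, (D, f) ∈ Q

/-- Reflexive: each value `f x`, `x ∈ D`, is a coordinate of some `y ∈ D`. -/
def ReflexiveFam {k : ℕ} (Q : Set (Finset (Fin k → ℕ) × ((Fin k → ℕ) → ℕ))) : Prop :=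
  ∀ p ∈ Q, ∀ x ∈ p.1, ∃ y ∈ p.1, ∃ i, p.2 x = y i

/-- Jump-free: if `x ∈ A ∩ B`, `A_x ⊆ B_x` and `f_A = f_B` on `A_x`, then `f_A x ≥ f_B x`. -/
def JumpFreeFam {k : ℕ} (Q : Set (Finset (Fin k → ℕ) × ((Fin k → ℕ) → ℕ))) : Prop :=
  ∀ A ∈ Q, ∀ B ∈ Q, ∀ x, x ∈ A.1 → x ∈ B.1 →
    (∀ z ∈ A.1, vmax z < vmax x → z ∈ B.1) →
    (∀ y ∈ A.1, vmax y < vmax x → A.2 y = B.2 y) →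
    B.2 x ≤ A.2 x

/-- Friedman's jump-free theorem (independent of ZFC), stated as a proposition to be
assumed as a hypothesis: for every full, reflexive, jump-free family `Q` on `ℕ^k` and
every `p > 0` there are a finite `D`, an `E` with `|E| = p` and `E^k ⊆ D`, and an
`f ∈ Q` with domain `D` that is regressively regular over `E^k`. -/
def JumpFreeTheorem (k : ℕ) : Prop :=
  ∀ Q : Set (Finset (Fin k → ℕ) × ((Fin k → ℕ) → ℕ)),
    FullFam Q → ReflexiveFam Q → JumpFreeFam Q →
    ∀ p : ℕ, 0 < p →
      ∃ D E f, (D, f) ∈ Q ∧ E.card = p ∧ cube k E ⊆ D ∧ RegressivelyRegular E f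

/-- `ℱ_G = {F^x_r}` is a family of partial selection functions on the out-neighborhoods
of `G = (ℕ^k, Θ)`: `F x r` is the partial function `F^x_r : (G^x × ℕ)^r ⇀ ℕ`
(`none` = undefined); whenever defined, its value is one of the `n_i`, and its domain
consists of tuples whose first components are out-neighbors of `x`. -/
def IsSelectionFamily {k : ℕ} (Θ : Set ((Fin k → ℕ) × (Fin k → ℕ)))
    (F : (Fin k → ℕ) → (r : ℕ) → (Fin r → (Fin k → ℕ) × ℕ) → Option ℕ) : Prop :=
  ∀ x r args n, F x r args = some n → (∃ i, n = (args i).2) ∧ ∀ i, (x, (args i).1) ∈ Θ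

/-- `Φ^D_x` relative to a labeling `g`: all defined values
`F^x_r((y₁, g y₁), …, (y_r, g y_r))` with `r ≥ 1` and `y₁, …, y_r ∈ G^x_D`. -/
def Phi {k : ℕ} (Θ : Set ((Fin k → ℕ) × (Fin k → ℕ)))
    (F : (Fin k → ℕ) → (r : ℕ) → (Fin r → (Fin k → ℕ) × ℕ) → Option ℕ)
    (D : Finset (Fin k → ℕ)) (g : (Fin k → ℕ) → ℕ) (x : Fin k → ℕ) : Set ℕ :=
  {n | ∃ r, 1 ≤ r ∧ ∃ y : Fin r → (Fin k → ℕ),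
    ∃ _ : ∀ i, y i ∈ D ∧ (x, y i) ∈ Θ,
    F x r (fun i => (y i, g (y i))) = some n}

open Classical in
/-- The selection labeling function `s_D`, defined by recursion on `vmax x`:
`s_D x = min Φ^D_x` if `Φ^D_x ≠ ∅` (where `Φ^D_x = Phi Θ F D (s_D) x`), and
`s_D x = min x` otherwise. -/
noncomputable def sD {k : ℕ} (Θ : Set ((Fin k → ℕ) × (Fin k → ℕ))) (hΘ : Downward Θ)
    (F : (Fin k → ℕ) → (r : ℕ) → (Fin r → (Fin k → ℕ) × ℕ) → Option ℕ)
    (D : Finset (Fin k → ℕ)) (x : Fin k → ℕ) : ℕ :=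
  let Φ : Set ℕ := {n | ∃ r, 1 ≤ r ∧ ∃ y : Fin r → (Fin k → ℕ),
    ∃ _ : ∀ i, y i ∈ D ∧ (x, y i) ∈ Θ,
    F x r (fun i => (y i, sD Θ hΘ F D (y i))) = some n}
  if Φ.Nonempty then sInf Φ else vmin x
termination_by vmax x
decreasing_by
  have h : ∀ i, y i ∈ D ∧ (x, y i) ∈ Θ := by assumption
  exact hΘ _ (h i).2

open Classical in
/-- The relaxed selection labeling function `ŝ_D`: `s_D x` if `Φ^D_x ≠ ∅`,
and `max x` otherwise. -/
noncomputable def sDhat {k : ℕ} (Θ : Set ((Fin k → ℕ) × (Fin k → ℕ))) (hΘ : Downward Θ)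
    (F : (Fin k → ℕ) → (r : ℕ) → (Fin r → (Fin k → ℕ) × ℕ) → Option ℕ)
    (D : Finset (Fin k → ℕ)) (x : Fin k → ℕ) : ℕ :=
  if (Phi Θ F D (sD Θ hΘ F D) x).Nonempty then sD Θ hΘ F D x else vmax x

/-- The maximal downward edge set `Θ = {(x, y) : max x > max y}`. -/
def maxTheta (k : ℕ) : Set ((Fin k → ℕ) × (Fin k → ℕ)) := {e | vmax e.2 < vmax e.1}

theorem maxTheta_downward (k : ℕ) : Downward (maxTheta k) := fun _ he => he

theorem vmin_le_vmax {k : ℕ} (x : Fin k → ℕ) : vmin x ≤ vmax x := by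
  rcases Nat.eq_zero_or_pos k with rfl | hk
  · simp [vmin, vmax, Set.range_eq_empty]
  · have hx : x ⟨0, hk⟩ ∈ Set.range x := Set.mem_range_self _
    exact (Nat.sInf_le hx).trans (le_csSup (Set.finite_range x).bddAbove hx)

/-- Along a chain of edges of a downward graph the maximal coordinate strictly decreases. -/
theorem Downward.pairwise_of_isChain {k : ℕ} {Θ : Set ((Fin k → ℕ) × (Fin k → ℕ))}
    (hΘ : Downward Θ) {l : List (Fin k → ℕ)} (hl : l.IsChain fun a b => (a, b) ∈ Θ) :
    l.Pairwise fun a b => vmax b < vmax a := by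
  have : IsTrans (Fin k → ℕ) fun a b => vmax b < vmax a := ⟨fun _ _ _ h₁ h₂ => h₂.trans h₁⟩
  exact List.isChain_iff_pairwise.1 (hl.imp fun a b h => hΘ (a, b) h)

/-- Distinctness of the vertices is automatic in a downward graph. -/
theorem Downward.isPath_iff {k : ℕ} {Θ : Set ((Fin k → ℕ) × (Fin k → ℕ))} (hΘ : Downward Θ)
    {D : Finset (Fin k → ℕ)} {l : List (Fin k → ℕ)} :
    IsPath Θ D l ↔ l ≠ [] ∧ (∀ x ∈ l, x ∈ D) ∧ l.IsChain fun a b => (a, b) ∈ Θ := by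
  refine ⟨fun h => ⟨h.1, h.2.2.1, h.2.2.2⟩, fun h => ⟨h.1, ?_, h.2.1, h.2.2⟩⟩
  exact (hΘ.pairwise_of_isChain h.2.2).imp fun h e => by simp [e] at h

/-- A path is terminal exactly when its last vertex has no out-neighbor in `D`. -/
theorem Downward.isTerminalPath_iff {k : ℕ} {Θ : Set ((Fin k → ℕ) × (Fin k → ℕ))}
    (hΘ : Downward Θ) {D : Finset (Fin k → ℕ)} {l : List (Fin k → ℕ)} {w : Fin k → ℕ}
    (hw : l.getLast? = some w) :
    IsTerminalPath Θ D l ↔ IsPath Θ D l ∧ ∀ y ∈ D, (w, y) ∉ Θ := by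
  refine and_congr_right fun hl => forall_congr' fun y => ?_
  obtain ⟨h₁, h₂, h₃⟩ := hΘ.isPath_iff.1 hl
  rw [hΘ.isPath_iff, List.isChain_append]
  simp only [hw, List.mem_append, List.mem_singleton, Option.mem_def, Option.some.injEq,
    List.head?_cons]
  constructor
  · intro h hy he
    refine h ⟨by simp, ?_, h₃, by simp, ?_⟩
    · rintro z (hz | rfl)
      exacts [h₂ z hz, hy]
    · rintro _ rfl _ rfl
      exact he
  · rintro h ⟨-, hD, -, -, he⟩
    exact h (hD y (Or.inr rfl)) (he w rfl y rfl)

theorem Downward.isTerminalPath_singleton_iff {k : ℕ} {Θ : Set ((Fin k → ℕ) × (Fin k → ℕ))}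
    (hΘ : Downward Θ) {D : Finset (Fin k → ℕ)} {z : Fin k → ℕ} (hz : z ∈ D) :
    IsTerminalPath Θ D [z] ↔ ∀ y ∈ D, (z, y) ∉ Θ := by
  rw [hΘ.isTerminalPath_iff (w := z) rfl, hΘ.isPath_iff]
  simp [hz]

theorem tD_le_vmin {k : ℕ} (Θ : Set ((Fin k → ℕ) × (Fin k → ℕ))) (D : Finset (Fin k → ℕ))
    (z : Fin k → ℕ) : tD Θ D z ≤ vmin z :=
  Nat.sInf_le (Or.inr rfl)

theorem tD_le_of_mem {k : ℕ} {Θ : Set ((Fin k → ℕ) × (Fin k → ℕ))} {D : Finset (Fin k → ℕ)}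
    {z w : Fin k → ℕ} (hw : w ∈ TD Θ D z) : tD Θ D z ≤ vmin w :=
  Nat.sInf_le (Or.inl ⟨w, hw, rfl⟩)

theorem tDhat_le_vmax {k : ℕ} (Θ : Set ((Fin k → ℕ) × (Fin k → ℕ))) (D : Finset (Fin k → ℕ))
    (z : Fin k → ℕ) : tDhat Θ D z ≤ vmax z := by
  unfold tDhat
  split_ifs
  exacts [le_rfl, (tD_le_vmin Θ D z).trans (vmin_le_vmax z)]

theorem Downward.TD_subset_of_edge {k : ℕ} {Θ : Set ((Fin k → ℕ) × (Fin k → ℕ))}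
    (hΘ : Downward Θ) {D : Finset (Fin k → ℕ)} {z y : Fin k → ℕ} (hz : z ∈ D)
    (he : (z, y) ∈ Θ) : TD Θ D y ⊆ TD Θ D z := by
  rintro w ⟨l, hl, hhead, hlast⟩
  obtain ⟨hp, ht⟩ := (hΘ.isTerminalPath_iff hlast).1 hl
  obtain ⟨h₁, h₂, h₃⟩ := hΘ.isPath_iff.1 hp
  have hlast' : (z :: l).getLast? = some w := by
    rw [List.getLast?_cons_of_ne_nil h₁, hlast]
  refine ⟨z :: l, (hΘ.isTerminalPath_iff hlast').2 ⟨hΘ.isPath_iff.2 ⟨by simp, ?_, ?_⟩, ht⟩,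
    rfl, hlast'⟩
  · rintro v (_ | ⟨_, hv⟩)
    exacts [hz, h₂ v hv]
  · refine List.isChain_cons.2 ⟨fun v hv => ?_, h₃⟩
    rw [hhead] at hv
    cases hv
    exact he

theorem Downward.exists_mem_TD {k : ℕ} {Θ : Set ((Fin k → ℕ) × (Fin k → ℕ))}
    (hΘ : Downward Θ) {D : Finset (Fin k → ℕ)} {z : Fin k → ℕ} (hz : z ∈ D) :
    ∃ w ∈ TD Θ D z, vmax w ≤ vmax z := by
  induction hn : vmax z using Nat.strong_induction_on generalizing z with
  | _ n ih =>
    subst hn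
    by_cases h : IsTerminalPath Θ D [z]
    · exact ⟨z, ⟨[z], h, rfl, rfl⟩, le_rfl⟩
    · simp only [hΘ.isTerminalPath_singleton_iff hz, not_forall, not_not] at h
      obtain ⟨y, hy, he⟩ := h
      obtain ⟨w, hw, hle⟩ := ih _ (hΘ _ he) hy rfl
      exact ⟨w, hΘ.TD_subset_of_edge hz he hw, hle.trans (hΘ _ he).le⟩

/-- The relaxed label takes the value `max z` only at vertices without out-neighbors. -/
theorem Downward.tDhat_eq_vmax_iff {k : ℕ} {Θ : Set ((Fin k → ℕ) × (Fin k → ℕ))}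
    (hΘ : Downward Θ) {D : Finset (Fin k → ℕ)} {z : Fin k → ℕ} (hz : z ∈ D) :
    tDhat Θ D z = vmax z ↔ ∀ y ∈ D, (z, y) ∉ Θ := by
  rw [← hΘ.isTerminalPath_singleton_iff hz]
  refine ⟨fun h => ?_, fun h => if_pos h⟩
  by_contra hnt
  rw [tDhat, if_neg hnt] at h
  simp only [hΘ.isTerminalPath_singleton_iff hz, not_forall, not_not] at hnt
  obtain ⟨y, hy, he⟩ := hnt
  obtain ⟨w, hw, hle⟩ := hΘ.exists_mem_TD hy
  have h₁ := tD_le_of_mem (hΘ.TD_subset_of_edge hz he hw)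
  have h₂ : vmax y < vmax z := hΘ _ he
  have h₃ := vmin_le_vmax w
  omega

theorem Downward.tDhat_le_tDhat {k : ℕ} {Θ : Set ((Fin k → ℕ) × (Fin k → ℕ))}
    (hΘ : Downward Θ) {A B : Finset (Fin k → ℕ)} {x : Fin k → ℕ} (hxA : x ∈ A) (hxB : x ∈ B)
    (hAB : ∀ z ∈ A, vmax z < vmax x → z ∈ B)
    (heq : ∀ y ∈ A, vmax y < vmax x → tDhat Θ A y = tDhat Θ B y) :
    tDhat Θ B x ≤ tDhat Θ A x := by
  by_cases hA : IsTerminalPath Θ A [x]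
  · rw [tDhat.eq_def Θ A, if_pos hA]
    exact tDhat_le_vmax Θ B x
  have hB : ¬ IsTerminalPath Θ B [x] := by
    rw [hΘ.isTerminalPath_singleton_iff hxA] at hA
    rw [hΘ.isTerminalPath_singleton_iff hxB]
    exact fun h => hA fun y hy he => h y (hAB y hy (hΘ _ he)) he
  rw [tDhat, tDhat, if_neg hA, if_neg hB]
  have hmem : tD Θ A x ∈ vmin '' TD Θ A x ∪ {vmin x} := Nat.sInf_mem ⟨_, Or.inr rfl⟩
  rcases hmem with ⟨w, ⟨l, hl, hhead, hlast⟩, hw⟩ | hx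
  · rw [← hw]
    obtain ⟨hp, ht⟩ := (hΘ.isTerminalPath_iff hlast).1 hl
    obtain ⟨-, h₂, h₃⟩ := hΘ.isPath_iff.1 hp
    obtain ⟨l, rfl⟩ : ∃ m, l = x :: m := by
      cases l with
      | nil => simp at hhead
      | cons a m => exact ⟨m, by simpa using hhead⟩
    have hlt := (List.pairwise_cons.1 (hΘ.pairwise_of_isChain h₃)).1
    have hwl : w ∈ l := by
      have hne : l ≠ [] := by
        rintro rfl
        exact hA hl
      rw [List.getLast?_cons_of_ne_nil hne] at hlast
      exact List.mem_of_getLast? hlast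
    have hwA : w ∈ A := h₂ w (List.mem_cons_of_mem _ hwl)
    have hwB : w ∈ B := hAB w hwA (hlt w hwl)
    refine tD_le_of_mem ⟨x :: l, (hΘ.isTerminalPath_iff hlast).2 ⟨hΘ.isPath_iff.2
      ⟨by simp, ?_, h₃⟩, ?_⟩, rfl, hlast⟩
    · rintro v (_ | ⟨_, hv⟩)
      exacts [hxB, hAB v (h₂ v (List.mem_cons_of_mem _ hv)) (hlt v hv)]
    · rw [← hΘ.tDhat_eq_vmax_iff hwB, ← heq w hwA (hlt w hwl)]
      exact (hΘ.tDhat_eq_vmax_iff hwA).2 ht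
  · rw [hx]
    exact tD_le_vmin Θ B x

/-- The family `Q = {t̂_D : D ⊆ ℕ^k finite}` of relaxed terminal label functions is
jump-free. -/
theorem tDhat_jumpFree {k : ℕ} (hk : 2 ≤ k)
    (Θ : Set ((Fin k → ℕ) × (Fin k → ℕ))) (hΘ : Downward Θ) :
    JumpFreeFam {q : Finset (Fin k → ℕ) × ((Fin k → ℕ) → ℕ) | q.2 = tDhat Θ q.1} ∧
    ∀ (A B : Finset (Fin k → ℕ)) (x : Fin k → ℕ), x ∈ A → x ∈ B →
      (∀ z ∈ A, vmax z < vmax x → z ∈ B) →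
      (∀ y ∈ A, vmax y < vmax x → tDhat Θ A y = tDhat Θ B y) →
      tDhat Θ B x ≤ tDhat Θ A x := by
  refine ⟨?_, fun A B x => hΘ.tDhat_le_tDhat⟩
  rintro ⟨A, f⟩ (rfl : f = tDhat Θ A) ⟨B, g⟩ (rfl : g = tDhat Θ B) x
  exact hΘ.tDhat_le_tDhat

end LatticeMultiverse
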